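/- arXiv:math-ph/0408015 — 2 statements merged into one kernel-verified Lean document; each statement's English description precedes it below -/
import Mathlib

section
/- Let k ≥ 1, l ≥ 0, m ≥ 0 be integers and set n = 2k + m. Let N(k,l,m) be the number of favorable paths γ of length n with k_1(γ) = k, l_{13}(γ) = l and l_{23}(γ) = m, and let N_1(k,l,m) be the number of such paths with additionally γ(0) = 1. If l ≡ m (mod 2), then N_1(k,l,m) = Σ_{0 ≤ j ≤ k, j ≡ m (mod 2)} C(k,j) · C((m−j)/2 + k − 1, k−1) · C(k−j, (l−j)/2) · 2^j, and k · N(k,l,m) = (2k+m) · N_1(k,l,m). If l ≢ m (mod 2), then N(k,l,m) = 0. -/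
/-- Binomial coefficient with integer arguments, equal to `0` unless `0 ≤ b ≤ a`. -/
def intChoose (a b : ℤ) : ℕ :=
  if 0 ≤ b ∧ b ≤ a then Nat.choose a.toNat b.toNat else 0

/-- The number of favorable paths `γ` of length `n = 2k+m` (cyclic paths on `Fin 3`
with no two consecutive values equal) with `k₁(γ) = k`, `l₁₃(γ) = l`, `l₂₃(γ) = m`
(states `0,1,2` of `Fin 3` standing for `1,2,3`). -/
noncomputable def favN (k l m : ℕ) : ℕ :=
  Nat.card {γ : ZMod (2 * k + m) → Fin 3 //
    (∀ i, γ i ≠ γ (i + 1)) ∧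
    Nat.card {i : ZMod (2 * k + m) // γ i = 0} = k ∧
    Nat.card {i : ZMod (2 * k + m) // ({γ i, γ (i + 1)} : Finset (Fin 3)) = {0, 2}} = l ∧
    Nat.card {i : ZMod (2 * k + m) // ({γ i, γ (i + 1)} : Finset (Fin 3)) = {1, 2}} = m}

/-- As `favN`, but additionally requiring `γ 0 = 0` (the path starts at state `1`). -/
noncomputable def favN1 (k l m : ℕ) : ℕ :=
  Nat.card {γ : ZMod (2 * k + m) → Fin 3 //
    (∀ i, γ i ≠ γ (i + 1)) ∧
    Nat.card {i : ZMod (2 * k + m) // γ i = 0} = k ∧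
    Nat.card {i : ZMod (2 * k + m) // ({γ i, γ (i + 1)} : Finset (Fin 3)) = {0, 2}} = l ∧
    Nat.card {i : ZMod (2 * k + m) // ({γ i, γ (i + 1)} : Finset (Fin 3)) = {1, 2}} = m ∧
    γ 0 = 0}

theorem Matrix.pow_succ_apply_eq_sum {S R : Type*} [Fintype S] [DecidableEq S] [CommSemiring R]
    (M : Matrix S S R) (n : ℕ) (s e : S) :
    (M ^ (n + 1)) s e = ∑ γ : Fin (n + 1) → S, if γ 0 = s then
      (∏ i : Fin n, M (γ i.castSucc) (γ i.succ)) * M (γ (Fin.last n)) e else 0 := by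
  induction n generalizing s with
  | zero =>
    rw [← (Equiv.funUnique (Fin 1) S).symm.sum_comp]
    simp [Equiv.funUnique, uniqueElim_const]
  | succ n ih =>
    rw [pow_succ', Matrix.mul_apply, ← (Fin.consEquiv fun _ => S).sum_comp, Fintype.sum_prod_type]
    simp only [Fin.consEquiv_apply, Fin.cons_zero, ← Fin.succ_last, Fin.cons_succ,
      Fin.prod_univ_succ, Fin.castSucc_zero, ← Fin.succ_castSucc, ih]
    trans ∑ γ : Fin (n + 1) → S, M s (γ 0) *
      ((∏ i : Fin n, M (γ i.castSucc) (γ i.succ)) * M (γ (Fin.last n)) e)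
    · simp only [Finset.mul_sum]
      rw [Finset.sum_comm]
      simp
    · rw [Finset.sum_eq_single s (by intro b _ hb; simp [hb]) (by simp)]
      simp [mul_assoc]

theorem Matrix.pow_succ_apply_self_eq_sum {S R : Type*} [Fintype S] [DecidableEq S]
    [CommSemiring R] (M : Matrix S S R) (n : ℕ) (s : S) :
    (M ^ (n + 1)) s s = ∑ γ : ZMod (n + 1) → S, if γ 0 = s then
      ∏ i, M (γ i) (γ (i + 1)) else 0 := by
  rw [Matrix.pow_succ_apply_eq_sum]
  change _ = ∑ γ : Fin (n + 1) → S, if γ 0 = s then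
      ∏ i : Fin (n + 1), M (γ i) (γ (i + 1)) else 0
  refine Finset.sum_congr rfl fun γ _ => ?_
  split_ifs with h
  · rw [Fin.prod_univ_castSucc]
    simp [Fin.last_add_one, h]
  · rfl

open Polynomial in
/-- Transfer matrix whose outer variable marks visits of `0` and whose inner variable marks
edges `{0, 2}`. -/
noncomputable def favMatrix : Matrix (Fin 3) (Fin 3) ℤ[X][X] :=
  Matrix.of fun a b => if a ≠ b then
    C (X ^ (if ({a, b} : Finset (Fin 3)) = {0, 2} then 1 else 0)) * X ^ (if a = 0 then 1 else 0)
  else 0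

theorem natCard_subtype_eq_sum {α : Type*} [Fintype α] (p : α → Prop) [DecidablePred p] :
    Nat.card {a // p a} = ∑ a, if p a then 1 else 0 := by
  rw [Nat.card_eq_fintype_card, Fintype.card_subtype, Finset.card_filter]

theorem coeff_coeff_favMatrix_pow (n k l : ℕ) :
    (((favMatrix ^ (n + 1)) 0 0).coeff k).coeff l =
      (Nat.card {γ : ZMod (n + 1) → Fin 3 // (∀ i, γ i ≠ γ (i + 1)) ∧
        Nat.card {i : ZMod (n + 1) // γ i = 0} = k ∧
        Nat.card {i : ZMod (n + 1) // ({γ i, γ (i + 1)} : Finset (Fin 3)) = {0, 2}} = l ∧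
        γ 0 = 0} : ℤ) := by
  classical
  rw [Matrix.pow_succ_apply_self_eq_sum, natCard_subtype_eq_sum, Polynomial.finsetSum_coeff,
    Polynomial.finsetSum_coeff, Nat.cast_sum]
  refine Finset.sum_congr rfl fun γ _ => ?_
  by_cases h0 : γ 0 = 0
  swap
  · simp [h0]
  by_cases h : ∀ i, γ i ≠ γ (i + 1)
  · have : ∏ i, favMatrix (γ i) (γ (i + 1)) =
        Polynomial.C (Polynomial.X ^
          Nat.card {i : ZMod (n + 1) // ({γ i, γ (i + 1)} : Finset (Fin 3)) = {0, 2}}) *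
        Polynomial.X ^ Nat.card {i : ZMod (n + 1) // γ i = 0} := by
      rw [natCard_subtype_eq_sum, natCard_subtype_eq_sum, ← Finset.prod_pow_eq_pow_sum,
        ← Finset.prod_pow_eq_pow_sum, map_prod, ← Finset.prod_mul_distrib]
      refine Finset.prod_congr rfl fun i _ => ?_
      simp [favMatrix, h i]
    rw [if_pos h0, this, Polynomial.coeff_C_mul_X_pow]
    simp only [h0, h, ne_eq, not_false_eq_true, implies_true, true_and, and_true, eq_comm (a := k)]
    split_ifs with h1 h2 h2
    · rw [Polynomial.coeff_X_pow, if_pos h2.2.symm, Nat.cast_one]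
    · rw [Polynomial.coeff_X_pow, if_neg fun h3 => h2 ⟨h1, h3.symm⟩, Nat.cast_zero]
    · exact absurd h2.1 h1
    · simp
  · rw [if_pos h0, if_neg fun h' => h h'.1]
    push Not at h
    obtain ⟨i, hi⟩ := h
    rw [Finset.prod_eq_zero (Finset.mem_univ i) (by simp [favMatrix, hi])]
    simp

theorem indicator_zero_add_indicator_zero_add {a b : Fin 3} (h : a ≠ b) :
    (if a = 0 then 1 else 0) + (if b = 0 then 1 else 0) +
      (if ({a, b} : Finset (Fin 3)) = {1, 2} then 1 else 0) = 1 := by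
  revert a b; decide

theorem indicator_two_add_indicator_two {a b : Fin 3} (h : a ≠ b) :
    (if a = 2 then 1 else 0) + (if b = 2 then 1 else 0) =
      (if ({a, b} : Finset (Fin 3)) = {0, 2} then 1 else 0) +
      (if ({a, b} : Finset (Fin 3)) = {1, 2} then 1 else 0) := by
  revert a b; decide

theorem two_mul_card_add_card {n : ℕ} [NeZero n] {γ : ZMod n → Fin 3}
    (h : ∀ i, γ i ≠ γ (i + 1)) :
    2 * Nat.card {i : ZMod n // γ i = 0} +
      Nat.card {i : ZMod n // ({γ i, γ (i + 1)} : Finset (Fin 3)) = {1, 2}} = n := by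
  have e1 : Nat.card {i : ZMod n // γ i = 0} =
      ∑ i, if γ i = 0 then 1 else 0 :=
    natCard_subtype_eq_sum _
  have e2 : Nat.card {i : ZMod n // ({γ i, γ (i + 1)} : Finset (Fin 3)) = {1, 2}} =
      ∑ i, if ({γ i, γ (i + 1)} : Finset (Fin 3)) = {1, 2} then 1 else 0 :=
    natCard_subtype_eq_sum _
  have h1 := Finset.sum_congr (s₁ := Finset.univ) rfl fun i _ =>
    indicator_zero_add_indicator_zero_add (h i)
  simp only [Finset.sum_add_distrib, Finset.sum_const, Finset.card_univ, ZMod.card] at h1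
  have h2 : ∑ i, (if γ (i + 1) = 0 then 1 else 0) = ∑ i, if γ i = 0 then 1 else 0 :=
    Equiv.sum_comp (Equiv.addRight (1 : ZMod n)) fun i => if γ i = 0 then 1 else 0
  simp only [smul_eq_mul, mul_one] at h1
  omega

theorem card_add_card_mod_two {n : ℕ} [NeZero n] {γ : ZMod n → Fin 3}
    (h : ∀ i, γ i ≠ γ (i + 1)) :
    Nat.card {i : ZMod n // ({γ i, γ (i + 1)} : Finset (Fin 3)) = {0, 2}} % 2 =
      Nat.card {i : ZMod n // ({γ i, γ (i + 1)} : Finset (Fin 3)) = {1, 2}} % 2 := by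
  have e1 : Nat.card {i : ZMod n // ({γ i, γ (i + 1)} : Finset (Fin 3)) = {0, 2}} =
      ∑ i, if ({γ i, γ (i + 1)} : Finset (Fin 3)) = {0, 2} then 1 else 0 :=
    natCard_subtype_eq_sum _
  have e2 : Nat.card {i : ZMod n // ({γ i, γ (i + 1)} : Finset (Fin 3)) = {1, 2}} =
      ∑ i, if ({γ i, γ (i + 1)} : Finset (Fin 3)) = {1, 2} then 1 else 0 :=
    natCard_subtype_eq_sum _
  have h1 := Finset.sum_congr (s₁ := Finset.univ) rfl fun i _ =>
    indicator_two_add_indicator_two (h i)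
  simp only [Finset.sum_add_distrib] at h1
  have h2 : ∑ i, (if γ (i + 1) = 2 then 1 else 0) = ∑ i, if γ i = 2 then 1 else 0 :=
    Equiv.sum_comp (Equiv.addRight (1 : ZMod n)) fun i => if γ i = 2 then 1 else 0
  omega

theorem favN1_eq_coeff (k l m : ℕ) (hk : 1 ≤ k) :
    (favN1 k l m : ℤ) = (((favMatrix ^ (2 * k + m)) 0 0).coeff k).coeff l := by
  unfold favN1
  have hm {γ : ZMod (2 * k + m) → Fin 3} (h : ∀ i, γ i ≠ γ (i + 1))
      (h0 : Nat.card {i : ZMod (2 * k + m) // γ i = 0} = k) :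
      Nat.card {i : ZMod (2 * k + m) // ({γ i, γ (i + 1)} : Finset (Fin 3)) = {1, 2}} = m := by
    have : NeZero (2 * k + m) := ⟨by omega⟩
    have := two_mul_card_add_card h
    omega
  obtain ⟨n, hn⟩ : ∃ n, 2 * k + m = n + 1 := ⟨2 * k + m - 1, by omega⟩
  generalize 2 * k + m = N at *
  subst hn
  rw [coeff_coeff_favMatrix_pow]
  congr 1
  refine Nat.card_congr (Equiv.subtypeEquivRight fun γ => ?_)
  have := @hm γ
  tauto

theorem favN_eq_zero (k l m : ℕ) (hk : 1 ≤ k) (h : l % 2 ≠ m % 2) : favN k l m = 0 := by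
  have : NeZero (2 * k + m) := ⟨by omega⟩
  rw [favN, Nat.card_eq_zero]
  left
  rw [isEmpty_subtype]
  rintro γ ⟨h1, -, rfl, h3⟩
  have := card_add_card_mod_two h1
  exact h (this.trans (congrArg (· % 2) h3))

theorem natCard_mul_eq_of_translation_invariant {G : Type*} [AddGroup G] [Finite G]
    {S : Type*} [Finite S] (p : (G → S) → Prop) (s : S) (k : ℕ)
    (hp : ∀ γ g, p γ → p fun i => γ (i + g))
    (hk : ∀ γ, p γ → Nat.card {i // γ i = s} = k) :
    k * Nat.card {γ // p γ} = Nat.card G * Nat.card {γ // p γ ∧ γ 0 = s} := by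
  have e : (Σ γ : {γ // p γ}, {i // γ.1 i = s}) ≃ G × {γ // p γ ∧ γ 0 = s} :=
    { toFun := fun x => (x.2.1, ⟨fun i => x.1.1 (i + x.2.1), hp _ _ x.1.2,
        by simpa using x.2.2⟩)
      invFun := fun y => ⟨⟨fun i => y.2.1 (i + -y.1), hp _ _ y.2.2.1⟩,
        ⟨y.1, by simpa using y.2.2.2⟩⟩
      left_inv := by
        rintro ⟨⟨γ, h⟩, i, hi⟩
        refine Sigma.subtype_ext (Subtype.ext (funext fun j => ?_)) rfl
        simp
      right_inv := by
        rintro ⟨i, γ, h⟩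
        simp }
  have := Fintype.ofFinite {γ // p γ}
  rw [← Nat.card_prod, ← Nat.card_congr e, Nat.card_sigma]
  simp [hk _ (Subtype.property _), mul_comm]

theorem natCard_shift {G : Type*} [AddGroup G] (q : G → Prop) (g : G) :
    Nat.card {i // q (i + g)} = Nat.card {i // q i} :=
  Nat.card_congr ((Equiv.addRight g).subtypeEquiv fun _ => Iff.rfl)

theorem mul_favN_eq (k l m : ℕ) (hk : 1 ≤ k) :
    k * favN k l m = (2 * k + m) * favN1 k l m := by
  have : NeZero (2 * k + m) := ⟨by omega⟩
  have h := natCard_mul_eq_of_translation_invariant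
    (fun γ : ZMod (2 * k + m) → Fin 3 => (∀ i, γ i ≠ γ (i + 1)) ∧
      Nat.card {i : ZMod (2 * k + m) // γ i = 0} = k ∧
      Nat.card {i : ZMod (2 * k + m) // ({γ i, γ (i + 1)} : Finset (Fin 3)) = {0, 2}} = l ∧
      Nat.card {i : ZMod (2 * k + m) // ({γ i, γ (i + 1)} : Finset (Fin 3)) = {1, 2}} = m) 0 k
    (by
      rintro γ g ⟨h1, h2, h3, h4⟩
      simp only [add_right_comm _ (1 : ZMod (2 * k + m)) g]
      refine ⟨fun i => h1 _, ?_, ?_, ?_⟩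
      · exact (natCard_shift (fun i => γ i = 0) g).trans h2
      · exact (natCard_shift
          (fun i => ({γ i, γ (i + 1)} : Finset (Fin 3)) = {0, 2}) g).trans h3
      · exact (natCard_shift
          (fun i => ({γ i, γ (i + 1)} : Finset (Fin 3)) = {1, 2}) g).trans h4)
    (fun γ h => h.2.1)
  simpa only [favN, favN1, and_assoc, Nat.card_zmod] using h

/-- Coefficients of `(1 - t ^ 2) ^ (-(k + 1))`. -/
theorem one_sub_X_sq_pow_mul_mk_choose {R : Type*} [CommRing R] (k : ℕ) :
    (1 - PowerSeries.X ^ 2 : PowerSeries R) ^ (k + 1) *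
      PowerSeries.mk (fun i => if i % 2 = 0 then (Nat.choose (i / 2 + k) k : R) else 0) = 1 := by
  induction k with
  | zero =>
    ext n
    rw [zero_add, pow_one, sub_mul, one_mul, map_sub, PowerSeries.coeff_X_pow_mul',
      PowerSeries.coeff_one]
    simp only [PowerSeries.coeff_mk, Nat.choose_zero_right, Nat.cast_one]
    rcases n with _ | _ | n <;> simp [add_assoc]
  | succ k ih =>
    rw [pow_succ, mul_assoc]
    refine Eq.trans ?_ ih
    congr 1
    ext n
    rw [sub_mul, one_mul, map_sub, PowerSeries.coeff_X_pow_mul']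
    simp only [PowerSeries.coeff_mk]
    rcases n with _ | _ | n
    · simp
    · simp
    · have h : (n + 2) / 2 = n / 2 + 1 := by omega
      have h' : n + 1 + 1 - 2 = n := rfl
      have h'' : (n + 1 + 1) % 2 = n % 2 := by omega
      simp only [h, h', h'', le_add_iff_nonneg_left, zero_le, if_true]
      split_ifs with h1
      swap
      · simp
      rw [show n / 2 + 1 + (k + 1) = (n / 2 + (k + 1)) + 1 by ring, Nat.choose_succ_succ,
        show n / 2 + 1 + k = n / 2 + (k + 1) by ring]
      push_cast; ring

theorem favMatrix_eq : favMatrix =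
    !![0, Polynomial.X, Polynomial.C Polynomial.X * Polynomial.X;
      1, 0, 1;
      Polynomial.C Polynomial.X, 1, 0] := by
  have h1 : ({1, 0} : Finset (Fin 3)) ≠ {0, 2} := by decide
  have h2 : ({1, 2} : Finset (Fin 3)) ≠ {0, 2} := by decide
  have h3 : ({2, 0} : Finset (Fin 3)) = {0, 2} := by decide
  have h4 : ({2, 1} : Finset (Fin 3)) ≠ {0, 2} := by decide
  have h5 : ({0, 1} : Finset (Fin 3)) ≠ {0, 2} := by decide
  ext1 a b
  fin_cases a <;> fin_cases b <;> simp [favMatrix, h1, h2, h3, h4, h5]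

/-- Generating function, by length, of walks from `s` to `0` leaving `0` exactly `k` times. -/
noncomputable def favSeries (k : ℕ) (s : Fin 3) : PowerSeries (Polynomial ℤ) :=
  PowerSeries.mk fun n => ((favMatrix ^ n) s 0).coeff k

theorem favSeries_one (k : ℕ) :
    favSeries k 1 = PowerSeries.X * (favSeries k 0 + favSeries k 2) := by
  have hM : favMatrix 1 = ![1, 0, 1] := by
    rw [favMatrix_eq]; rfl
  ext1 n
  rcases n with _ | n
  · simp [favSeries]
  · rw [PowerSeries.coeff_succ_X_mul]
    simp [favSeries, pow_succ', Matrix.mul_apply, Fin.sum_univ_three, hM]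

theorem favSeries_two (k : ℕ) :
    favSeries k 2 =
      PowerSeries.X * (PowerSeries.C Polynomial.X * favSeries k 0 + favSeries k 1) := by
  have hM : favMatrix 2 = ![Polynomial.C Polynomial.X, 1, 0] := by
    rw [favMatrix_eq]; rfl
  ext1 n
  rcases n with _ | n
  · simp [favSeries]
  · rw [PowerSeries.coeff_succ_X_mul]
    simp [favSeries, pow_succ', Matrix.mul_apply, Fin.sum_univ_three, hM]

theorem favSeries_succ_zero (k : ℕ) :
    favSeries (k + 1) 0 =
      PowerSeries.X * (favSeries k 1 + PowerSeries.C Polynomial.X * favSeries k 2) := by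
  have hM : favMatrix 0 = ![0, Polynomial.X, Polynomial.C Polynomial.X * Polynomial.X] := by
    rw [favMatrix_eq]; rfl
  ext1 n
  rcases n with _ | n
  · simp [favSeries, Polynomial.coeff_one]
  · rw [PowerSeries.coeff_succ_X_mul]
    simp [favSeries, pow_succ', Matrix.mul_apply, Fin.sum_univ_three, hM, mul_assoc]

theorem favSeries_zero_zero : favSeries 0 0 = 1 := by
  have hM : favMatrix 0 = ![0, Polynomial.X, Polynomial.C Polynomial.X * Polynomial.X] := by
    rw [favMatrix_eq]; rfl
  ext1 n
  rcases n with _ | n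
  · simp [favSeries]
  · simp [favSeries, pow_succ', Matrix.mul_apply, Fin.sum_univ_three, hM, mul_assoc]

theorem one_sub_X_sq_pow_mul_favSeries (k : ℕ) :
    (1 - PowerSeries.X ^ 2) ^ k * favSeries k 0 =
      PowerSeries.X ^ (2 * k) * (PowerSeries.C (2 * Polynomial.X) * PowerSeries.X +
        PowerSeries.C (1 + Polynomial.X ^ 2)) ^ k := by
  induction k with
  | zero => simp [favSeries_zero_zero]
  | succ k ih =>
    have h : (1 - PowerSeries.X ^ 2) * favSeries (k + 1) 0 =
        PowerSeries.X ^ 2 * (PowerSeries.C (2 * Polynomial.X) * PowerSeries.X +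
          PowerSeries.C (1 + Polynomial.X ^ 2)) * favSeries k 0 := by
      have h0 := favSeries_succ_zero k
      have h1 := favSeries_one k
      have h2 := favSeries_two k
      simp only [map_mul, map_add, map_one, map_pow, map_ofNat]
      generalize (PowerSeries.C Polynomial.X : PowerSeries (Polynomial ℤ)) = x at *
      generalize (PowerSeries.X : PowerSeries (Polynomial ℤ)) = t at *
      rw [h0]
      linear_combination (t + x * t ^ 2) * h1 + (t * x + t ^ 2) * h2
    calc
      _ = (1 - PowerSeries.X ^ 2) ^ k * ((1 - PowerSeries.X ^ 2) * favSeries (k + 1) 0) := by ring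
      _ = PowerSeries.X ^ 2 * (PowerSeries.C (2 * Polynomial.X) * PowerSeries.X +
          PowerSeries.C (1 + Polynomial.X ^ 2)) *
            ((1 - PowerSeries.X ^ 2) ^ k * favSeries k 0) := by
        rw [h]; ring
      _ = _ := by rw [ih]; ring

theorem favSeries_succ_eq (k : ℕ) :
    favSeries (k + 1) 0 = PowerSeries.X ^ (2 * (k + 1)) *
      ((PowerSeries.C (2 * Polynomial.X) * PowerSeries.X +
        PowerSeries.C (1 + Polynomial.X ^ 2)) ^ (k + 1) *
      PowerSeries.mk fun i =>
        if i % 2 = 0 then (Nat.choose (i / 2 + k) k : Polynomial ℤ) else 0) := by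
  have h1 := one_sub_X_sq_pow_mul_favSeries (k + 1)
  have h2 := one_sub_X_sq_pow_mul_mk_choose (R := Polynomial ℤ) k
  generalize PowerSeries.mk _ = H at *
  calc _ = favSeries (k + 1) 0 * ((1 - PowerSeries.X ^ 2) ^ (k + 1) * H) := by rw [h2, mul_one]
    _ = ((1 - PowerSeries.X ^ 2) ^ (k + 1) * favSeries (k + 1) 0) * H := by ring
    _ = _ := by rw [h1]; ring

theorem Polynomial.coeff_one_add_X_sq_pow {R : Type*} [CommSemiring R] (n i : ℕ) :
    ((1 + Polynomial.X ^ 2 : Polynomial R) ^ n).coeff i =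
      if i % 2 = 0 then (n.choose (i / 2) : R) else 0 := by
  have : (1 + Polynomial.X ^ 2 : Polynomial R) ^ n =
      Polynomial.expand R 2 ((1 + Polynomial.X) ^ n) := by simp
  rw [this, Polynomial.coeff_expand two_pos, Polynomial.coeff_one_add_X_pow]
  simp [Nat.dvd_iff_mod_eq_zero]

theorem coeff_coeff_favSeries (k l m : ℕ) :
    ((PowerSeries.coeff (2 * (k + 1) + m) (favSeries (k + 1) 0)).coeff l : ℤ) =
      ∑ j ∈ Finset.range (k + 1 + 1),
        if j ≤ m ∧ j ≤ l ∧ (m - j) % 2 = 0 ∧ (l - j) % 2 = 0 then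
        (((k + 1).choose j * ((m - j) / 2 + k).choose k * (k + 1 - j).choose ((l - j) / 2) * 2 ^ j
          : ℕ) : ℤ) else 0 := by
  rw [favSeries_succ_eq, add_comm, PowerSeries.coeff_X_pow_mul, add_pow, Finset.sum_mul, map_sum,
    Polynomial.finsetSum_coeff]
  refine Finset.sum_congr rfl fun j _ => ?_
  generalize hH : PowerSeries.mk _ = H
  have : (PowerSeries.C (2 * Polynomial.X) * PowerSeries.X) ^ j *
      PowerSeries.C (1 + Polynomial.X ^ 2 : Polynomial ℤ) ^ (k + 1 - j) *
      ((k + 1).choose j : PowerSeries (Polynomial ℤ)) * H =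
      PowerSeries.C (Polynomial.C (((k + 1).choose j : ℤ) * 2 ^ j) *
        (Polynomial.X ^ j * (1 + Polynomial.X ^ 2) ^ (k + 1 - j))) * (PowerSeries.X ^ j * H) := by
    simp only [map_mul, map_pow, map_natCast, map_ofNat]
    ring
  rw [this, PowerSeries.coeff_C_mul, PowerSeries.coeff_X_pow_mul', ← hH, PowerSeries.coeff_mk]
  by_cases h1 : j ≤ m
  swap
  · simp [h1]
  by_cases h2 : (m - j) % 2 = 0
  swap
  · simp [h2]
  rw [if_pos h1, if_pos h2, ← Polynomial.C_eq_natCast, Polynomial.coeff_mul_C,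
    Polynomial.coeff_C_mul,
    Polynomial.coeff_X_pow_mul', Polynomial.coeff_one_add_X_sq_pow]
  simp only [h1, h2, true_and, ite_and]
  split_ifs <;> simp
  ring

theorem intChoose_natCast (a b : ℕ) : intChoose a b = a.choose b := by
  unfold intChoose
  split_ifs with h
  · simp
  · rw [Nat.choose_eq_zero_of_lt (by omega)]

theorem intChoose_eq_zero {a b : ℤ} (h : ¬ (0 ≤ b ∧ b ≤ a)) : intChoose a b = 0 := if_neg h

theorem count_favorable_paths (k l m : ℕ) (hk : 1 ≤ k) :
    (l % 2 = m % 2 →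
      favN1 k l m =
        ∑ j ∈ Finset.range (k + 1),
          (if j % 2 = m % 2 then
            intChoose k j * intChoose (((m : ℤ) - j) / 2 + k - 1) ((k : ℤ) - 1) *
              intChoose ((k : ℤ) - j) (((l : ℤ) - j) / 2) * 2 ^ j
          else 0) ∧
      k * favN k l m = (2 * k + m) * favN1 k l m) ∧
    (l % 2 ≠ m % 2 → favN k l m = 0) := by
  refine ⟨fun hlm => ⟨?_, mul_favN_eq k l m hk⟩, favN_eq_zero k l m hk⟩
  obtain ⟨k, rfl⟩ : ∃ k', k = k' + 1 := ⟨k - 1, by omega⟩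
  have h := favN1_eq_coeff (k + 1) l m hk
  have h' := coeff_coeff_favSeries k l m
  rw [favSeries, PowerSeries.coeff_mk, ← h] at h'
  rw [← Nat.cast_inj (R := ℤ), h', Nat.cast_sum]
  refine Finset.sum_congr rfl fun j hj => ?_
  have hj : j ≤ k + 1 := by simpa [Nat.lt_succ_iff] using hj
  by_cases h1 : j % 2 = m % 2
  swap
  · rw [if_neg h1, if_neg (by omega), Nat.cast_zero]
  rw [if_pos h1]
  by_cases h2 : j ≤ m
  swap
  · rw [if_neg (by omega), intChoose_eq_zero (a := ((m : ℤ) - j) / 2 + _ - 1) (by omega)]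
    simp
  by_cases h3 : j ≤ l
  swap
  · rw [if_neg (by omega), intChoose_eq_zero (b := ((l : ℤ) - j) / 2) (by omega)]
    simp
  rw [if_pos (by omega), intChoose_natCast,
    show ((m : ℤ) - j) / 2 + (k + 1 : ℕ) - 1 = ((m - j) / 2 + k : ℕ) by omega,
    show ((k + 1 : ℕ) : ℤ) - 1 = k by omega,
    show ((k + 1 : ℕ) : ℤ) - j = (k + 1 - j : ℕ) by omega,
    show ((l : ℤ) - j) / 2 = ((l - j) / 2 : ℕ) by omega]
  simp only [intChoose_natCast]
end

section
/- Let k ≥ 1 be an integer and let v, ξ be real numbers. Then A_0(k;v,ξ) = (1+v)^k · e^ξ + ∫_0^1 [ Σ_{ℓ ≥ 0, 2ℓ+2 ≤ k} k!/(ℓ!·(ℓ+1)!·(k−2ℓ−2)!) · (1+sv)^{k−2ℓ−2} · ((1−v²)/2)^{ℓ+1} · ((1−s²)/2)^ℓ ] · e^{sξ} ds (the sum over ℓ is empty when k < 2). -/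
open Finset

/-- `bmvA k r v ξ = A_r(k; v, ξ)`, the double series
`Σ_m Σ_{j=0}^k C(k,j) · 2^{k+r−1} · ((m−j+2)/2)_{k+r−1} / (m+1)_{k+2r−1} · v^j · ξ^m/m!`. -/
noncomputable def bmvA (k r : ℕ) (v ξ : ℝ) : ℝ :=
  ∑' m : ℕ, ∑ j ∈ Finset.range (k + 1),
    (Nat.choose k j : ℝ) * 2 ^ (k + r - 1) *
      (ascPochhammer ℝ (k + r - 1)).eval (((m : ℝ) - j + 2) / 2) /
      (ascPochhammer ℝ (k + 2 * r - 1)).eval ((m : ℝ) + 1) *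
      v ^ j * ξ ^ m / (Nat.factorial m : ℝ)

section

open Polynomial

lemma ascPochhammer_eval_eq_prod_add (n : ℕ) (x : ℝ) :
    (ascPochhammer ℝ n).eval x = ∏ i ∈ range n, (x + i) := by
  induction n with
  | zero => simp
  | succ n ih => rw [ascPochhammer_succ_eval, ih, prod_range_succ]

lemma two_pow_mul_ascPochhammer_eval_half (n : ℕ) (x : ℝ) :
    2 ^ n * (ascPochhammer ℝ n).eval (x / 2) = ∏ i ∈ range n, (x + 2 * i) := by
  rw [ascPochhammer_eval_eq_prod_add, ← card_range n, ← prod_const, card_range,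
    ← prod_mul_distrib]
  exact prod_congr rfl fun i _ => by ring

/-- Partial fractions for a quotient of two monic split polynomials of the same degree. -/
lemma eval_nodal_div_eval_nodal {ι : Type*} [DecidableEq ι] (s : Finset ι) (u w : ι → ℝ)
    (hw : Set.InjOn w s) {x : ℝ} (hx : ∀ i ∈ s, x ≠ w i) :
    (Lagrange.nodal s u).eval x / (Lagrange.nodal s w).eval x =
      1 + ∑ i ∈ s, Lagrange.nodalWeight s w i * (Lagrange.nodal s u).eval (w i) / (x - w i) := by
  have hdeg : (Lagrange.nodal s u - Lagrange.nodal s w).degree < #s := by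
    refine (degree_sub_lt_left ?_ Lagrange.nodal_ne_zero ?_).trans_eq Lagrange.degree_nodal
    · rw [Lagrange.degree_nodal, Lagrange.degree_nodal]
    · rw [Lagrange.nodal_monic.leadingCoeff, Lagrange.nodal_monic.leadingCoeff]
  have h := congrArg (eval x) (Lagrange.eq_interpolate hw hdeg)
  rw [Lagrange.eval_interpolate_not_at_node _ hx, eval_sub] at h
  have hne := Lagrange.eval_nodal_not_at_node hx
  rw [div_eq_iff hne, add_mul, one_mul, eq_add_of_sub_eq h, add_comm, mul_comm]
  congr 2
  refine sum_congr rfl fun i hi => ?_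
  rw [eval_sub, Lagrange.eval_nodal_at_node hi, sub_zero]
  ring

lemma prod_range_two_mul_add_one (n : ℕ) :
    ∏ i ∈ range n, (2 * (i : ℝ) + 1) = (2 * n).factorial / (n.factorial * 2 ^ n) := by
  induction n with
  | zero => simp
  | succ n ih =>
    rw [prod_range_succ, ih, show 2 * (n + 1) = 2 * n + 1 + 1 by ring, Nat.factorial_succ,
      Nat.factorial_succ, Nat.factorial_succ]
    have := n.factorial_ne_zero
    push_cast
    field_simp
    ring

lemma prod_range_two_mul_add_one_sub (n d : ℕ) :
    ∏ i ∈ range (n + d), (2 * (i : ℝ) + 1 - 2 * n) =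
      (-1) ^ n * ((2 * n).factorial / (n.factorial * 2 ^ n)) *
        ((2 * d).factorial / (d.factorial * 2 ^ d)) := by
  rw [prod_range_add, ← prod_range_two_mul_add_one, ← prod_range_two_mul_add_one]
  congr 1
  · rw [← prod_range_reflect, ← card_range n, ← prod_const, card_range, ← prod_mul_distrib]
    refine prod_congr rfl fun i hi => ?_
    have : i + 1 ≤ n := mem_range.mp hi
    rw [Nat.sub_sub, add_comm 1 i, Nat.cast_sub this]
    push_cast
    ring
  · exact prod_congr rfl fun i _ => by push_cast; ring

lemma nodalWeight_range_neg_natCast (p e : ℕ) :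
    Lagrange.nodalWeight (range (p + 1 + e)) (fun i : ℕ => -(i : ℝ)) p =
      (-1) ^ p / (p.factorial * e.factorial) := by
  rw [Lagrange.nodalWeight, prod_inv_distrib]
  induction e with
  | zero =>
    have h : ∏ q ∈ range p, (-(p : ℝ) - -(q : ℝ)) = (-1) ^ p * p.factorial := by
      rw [← prod_range_add_one_eq_factorial, ← prod_range_reflect, Nat.cast_prod,
        ← card_range p, ← prod_const, card_range, ← prod_mul_distrib]
      refine prod_congr rfl fun i hi => ?_
      have : i + 1 ≤ p := mem_range.mp hi
      rw [Nat.sub_sub, add_comm 1 i, Nat.cast_sub this]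
      push_cast
      ring
    rw [add_zero, range_add_one, erase_insert (by simp), h, mul_inv, ← inv_pow]
    simp [div_eq_mul_inv]
  | succ e ih =>
    rw [← add_assoc, range_add_one, erase_insert_of_ne (by lia), prod_insert (by simp), mul_inv, ih,
      Nat.factorial_succ]
    have := p.factorial_ne_zero
    have := e.factorial_ne_zero
    push_cast
    rw [show -(p : ℝ) - -(p + 1 + e) = e + 1 by ring]
    field_simp

lemma choose_mul_nodalWeight_mul_eval_nodal {j p q e n d : ℕ} (hp : j + p = 2 * n)
    (hq : q + e = 2 * d) (hn : p + 1 + e = n + d) :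
    (Nat.choose (n + d + 1) j : ℝ) *
        (Lagrange.nodalWeight (range (n + d)) (fun i : ℕ => -(i : ℝ)) p *
          (Lagrange.nodal (range (n + d)) (fun i : ℕ => (j : ℝ) - 1 - 2 * i)).eval (-(p : ℝ))) =
      (n + d + 1) / 2 ^ (n + d) * ((-1) ^ j *
        ((-1) ^ n * (n + d).choose n * (2 * n).choose j * (2 * d).choose q)) := by
  have hN : (Lagrange.nodal (range (n + d)) (fun i : ℕ => (j : ℝ) - 1 - 2 * i)).eval (-(p : ℝ)) =
      ∏ i ∈ range (n + d), (2 * (i : ℝ) + 1 - 2 * n) := by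
    rw [Lagrange.eval_nodal]
    refine prod_congr rfl fun i _ => ?_
    have : (j : ℝ) + p = 2 * n := mod_cast hp
    linear_combination -this
  have hsign : (-1 : ℝ) ^ p = (-1) ^ j := by
    have : (-1 : ℝ) ^ (j + p) = 1 := by rw [hp]; simp
    rcases neg_one_pow_eq_or ℝ j with h | h <;> rw [pow_add, h] at this <;> rw [h] <;> linarith
  rw [hN, prod_range_two_mul_add_one_sub, ← hn, nodalWeight_range_neg_natCast, hn, hsign,
    show n + d + 1 = j + q by lia, Nat.cast_add_choose, Nat.cast_add_choose, ← hp, ← hq,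
    Nat.cast_add_choose, Nat.cast_add_choose, ← show n + d + 1 = j + q by lia,
    Nat.factorial_succ (n + d)]
  push_cast
  have := p.factorial_ne_zero
  have := e.factorial_ne_zero
  have := n.factorial_ne_zero
  have := d.factorial_ne_zero
  have := j.factorial_ne_zero
  have := q.factorial_ne_zero
  field_simp
  rw [pow_add]

lemma coeff_C_mul_X_sq_add_C_pow (b c : ℝ) (i m : ℕ) :
    ((C b * X ^ 2 + C c) ^ i : ℝ[X]).coeff m =
      if 2 ∣ m then b ^ (m / 2) * c ^ (i - m / 2) * i.choose (m / 2) else 0 := by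
  have : (C b * X ^ 2 + C c : ℝ[X]) ^ i = expand ℝ 2 (((X + C c) ^ i).comp (C b * X)) := by
    simp
  rw [this, coeff_expand two_pos]
  split_ifs
  · rw [comp_C_mul_X_coeff, coeff_X_add_C_pow]
    ring
  · rfl

lemma trinomial_sum_eq_coeff (K : ℕ) (s v : ℝ) :
    ∑ ℓ ∈ (range (K + 1)).filter (fun ℓ => 2 * ℓ + 2 ≤ K + 1),
      ((K + 1).factorial : ℝ) /
          ((ℓ.factorial : ℝ) * ((ℓ + 1).factorial : ℝ) * ((K + 1 - 2 * ℓ - 2).factorial : ℝ)) *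
        (1 + s * v) ^ (K + 1 - 2 * ℓ - 2) * ((1 - v ^ 2) / 2) ^ (ℓ + 1) * ((1 - s ^ 2) / 2) ^ ℓ =
    (K + 1) / 2 ^ K * (((1 + X) ^ 2 - (C s - C v * X) ^ 2) ^ K : ℝ[X]).coeff (K + 1) := by
  have hfac : ((1 + X) ^ 2 - (C s - C v * X) ^ 2 : ℝ[X]) =
      C 2 * ((C ((1 - v ^ 2) / 2) * X ^ 2 + C ((1 - s ^ 2) / 2)) + C (1 + s * v) * X) := by
    have h (y : ℝ) : (C 2 * C (y / 2) : ℝ[X]) = C y := by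
      rw [← C_mul, mul_div_cancel₀ y two_ne_zero]
    rw [mul_add, mul_add, ← mul_assoc, h, h]
    simp only [map_sub, map_add, map_mul, map_pow, map_one, map_ofNat]
    ring
  set a := 1 + s * v
  set b := (1 - v ^ 2) / 2
  set c := (1 - s ^ 2) / 2
  have hterm (i : ℕ) (hi : i ∈ range (K + 1)) :
      ((C b * X ^ 2 + C c) ^ i * (C a * X) ^ (K - i) * (K.choose i : ℝ[X])).coeff (K + 1) =
        if 2 ∣ i + 1 then K.choose i * a ^ (K - i) *
          (b ^ ((i + 1) / 2) * c ^ (i - (i + 1) / 2) * i.choose ((i + 1) / 2)) else 0 := by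
    have hi : i ≤ K := Nat.lt_succ_iff.mp (mem_range.mp hi)
    rw [mul_pow, ← C_pow, ← C_eq_natCast, coeff_mul_C, mul_left_comm, coeff_C_mul,
      show K + 1 = i + 1 + (K - i) by lia, coeff_mul_X_pow, coeff_C_mul_X_sq_add_C_pow]
    split_ifs <;> ring
  rw [hfac, mul_pow, ← C_pow, coeff_C_mul, ← mul_assoc, div_mul_cancel₀ _ (by positivity), add_pow,
    finsetSum_coeff, sum_congr rfl hterm, ← sum_filter, mul_sum]
  refine sum_nbij' (fun ℓ => 2 * ℓ + 1) (fun i => i / 2) ?_ ?_ ?_ ?_ ?_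
  · intro ℓ
    simp only [mem_filter, mem_range]
    lia
  · intro i
    simp only [mem_filter, mem_range]
    lia
  · intro ℓ _
    lia
  · intro i
    simp only [mem_filter, mem_range]
    lia
  · intro ℓ hℓ
    obtain ⟨e, rfl⟩ : ∃ e, K = (2 * ℓ + 1) + e := by
      rw [mem_filter] at hℓ
      exact Nat.exists_eq_add_of_le (by lia)
    rw [show 2 * ℓ + 1 + e + 1 - 2 * ℓ - 2 = e by lia, show (2 * ℓ + 1 + 1) / 2 = ℓ + 1 by lia,
      show 2 * ℓ + 1 - (ℓ + 1) = ℓ by lia, Nat.add_sub_cancel_left, Nat.cast_add_choose,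
      show (2 * ℓ + 1).choose (ℓ + 1) = (ℓ + 1 + ℓ).choose (ℓ + 1) by congr 1; lia,
      Nat.cast_add_choose, show ℓ + 1 + ℓ = 2 * ℓ + 1 by lia, Nat.factorial_succ (2 * ℓ + 1 + e)]
    have := ℓ.factorial_ne_zero
    have := (ℓ + 1).factorial_ne_zero
    have := (2 * ℓ + 1).factorial_ne_zero
    have := e.factorial_ne_zero
    push_cast
    field_simp

lemma coeff_sq_sub_sq_pow (K : ℕ) (s v : ℝ) :
    (((1 + X) ^ 2 - (C s - C v * X) ^ 2) ^ K : ℝ[X]).coeff (K + 1) =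
      ∑ j ∈ range (K + 2), (-1) ^ j * v ^ j * ∑ n ∈ range (K + 1),
        (-1) ^ n * K.choose n * (2 * n).choose j * (2 * (K - n)).choose (K + 1 - j) *
          s ^ (2 * n - j) := by
  have hlin (m j : ℕ) : ((C s - C v * X) ^ m : ℝ[X]).coeff j =
      (-1) ^ j * v ^ j * (m.choose j * s ^ (m - j)) := by
    have : (C s - C v * X : ℝ[X]) ^ m = ((X + C s) ^ m).comp (C (-v) * X) := by
      simp [sub_eq_neg_add]
    rw [this, comp_C_mul_X_coeff, coeff_X_add_C_pow, neg_pow]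
    ring
  have : ((1 + X) ^ 2 - (C s - C v * X) ^ 2 : ℝ[X]) ^ K = ∑ n ∈ range (K + 1),
      C ((-1) ^ n * (K.choose n : ℝ)) * ((C s - C v * X) ^ (2 * n) * (1 + X) ^ (2 * (K - n))) := by
    rw [sub_eq_neg_add, add_pow]
    refine sum_congr rfl fun n _ => ?_
    rw [neg_pow, ← pow_mul, ← pow_mul]
    simp
    ring
  rw [this, finsetSum_coeff]
  simp_rw [coeff_C_mul, coeff_mul, Nat.sum_antidiagonal_eq_sum_range_succ_mk, hlin,
    coeff_one_add_X_pow, mul_sum]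
  rw [sum_comm]
  refine sum_congr rfl fun j _ => sum_congr rfl fun n _ => ?_
  ring

lemma choose_mul_eval_nodal_div_eval_nodal (K : ℕ) {j : ℕ} (hj : j ≤ K + 1) {x : ℝ} (hx : 0 < x) :
    (K + 1).choose j * ((Lagrange.nodal (range K) (fun i : ℕ => (j : ℝ) - 1 - 2 * i)).eval x /
        (Lagrange.nodal (range K) (fun i : ℕ => -(i : ℝ))).eval x) =
      (K + 1).choose j + (K + 1) / 2 ^ K * ((-1) ^ j * ∑ n ∈ range (K + 1),
        (-1) ^ n * K.choose n * (2 * n).choose j * (2 * (K - n)).choose (K + 1 - j) /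
          (x + (2 * n - j : ℕ))) := by
  have hinj : Set.InjOn (fun i : ℕ => -(i : ℝ)) (range K) := fun i _ i' _ h => by simpa using h
  have hne (i : ℕ) (_ : i ∈ range K) : x ≠ -(i : ℝ) := by
    have : (0 : ℝ) ≤ i := i.cast_nonneg
    linarith
  rw [eval_nodal_div_eval_nodal _ _ _ hinj hne, mul_add, mul_one, mul_sum, mul_sum, mul_sum]
  congr 1
  have hodd {p : ℕ} (hp : p < K) (hpj : ¬ 2 ∣ j + p) :
      (Lagrange.nodal (range K) (fun i : ℕ => (j : ℝ) - 1 - 2 * i)).eval (-(p : ℝ)) = 0 := by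
    rw [Lagrange.eval_nodal]
    refine prod_eq_zero (i := (j + p) / 2) (mem_range.mpr (by lia)) ?_
    have : (j : ℝ) + p = 2 * ((j + p) / 2 : ℕ) + 1 := by
      exact_mod_cast (by lia : j + p = 2 * ((j + p) / 2) + 1)
    linear_combination -this
  have hL : ∀ p ∈ range K, (¬ 2 ∣ j + p) →
      (K + 1).choose j * (Lagrange.nodalWeight (range K) (fun i : ℕ => -(i : ℝ)) p *
        (Lagrange.nodal (range K) (fun i : ℕ => (j : ℝ) - 1 - 2 * i)).eval (-(p : ℝ)) /
          (x - -(p : ℝ))) = 0 := by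
    intro p hp hpj
    rw [hodd (mem_range.mp hp) hpj]
    simp
  rw [← sum_filter_of_ne fun p hp h => not_not.mp fun h' => h (hL p hp h'),
    ← sum_filter_of_ne (s := range (K + 1)) (p := fun n => j ≤ 2 * n ∧ 2 * n + 1 ≤ j + K)]
  · refine sum_nbij' (fun p => (j + p) / 2) (fun n => 2 * n - j) ?_ ?_ ?_ ?_ ?_
    · intro p
      simp only [mem_filter, mem_range]
      lia
    · intro n
      simp only [mem_filter, mem_range]
      lia
    · intro p
      simp only [mem_filter, mem_range]
      lia
    · intro n
      simp only [mem_filter, mem_range]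
      lia
    · intro p hp
      rw [mem_filter, mem_range] at hp
      obtain ⟨hp, n, hn⟩ := hp
      obtain ⟨d, rfl⟩ : ∃ d, K = n + d := Nat.exists_eq_add_of_le (by lia)
      have key := choose_mul_nodalWeight_mul_eval_nodal (j := j) (p := p) (q := n + d + 1 - j)
        (e := n + d - 1 - p) (n := n) (d := d) hn (by lia) (by lia)
      rw [show (j + p) / 2 = n by lia, Nat.add_sub_cancel_left, show 2 * n - j = p by lia,
        ← mul_div_assoc, key, sub_neg_eq_add]
      push_cast
      ring
  · intro n hn h
    by_contra hcon
    refine h ?_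
    rcases lt_or_ge (2 * n) j with h' | h'
    · simp [Nat.choose_eq_zero_of_lt h']
    · have : (2 * (K - n)).choose (K + 1 - j) = 0 :=
        Nat.choose_eq_zero_of_lt (by rw [mem_range] at hn; lia)
      simp [this]

/-- The polynomial weight appearing in the integral representation. -/
noncomputable def trinomialWeight (k : ℕ) (v s : ℝ) : ℝ :=
  ∑ ℓ ∈ (range k).filter (fun ℓ => 2 * ℓ + 2 ≤ k),
    (k.factorial : ℝ) / ((ℓ.factorial : ℝ) * ((ℓ + 1).factorial : ℝ) *
        ((k - 2 * ℓ - 2).factorial : ℝ)) *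
      (1 + s * v) ^ (k - 2 * ℓ - 2) * ((1 - v ^ 2) / 2) ^ (ℓ + 1) * ((1 - s ^ 2) / 2) ^ ℓ

lemma continuous_trinomialWeight (k : ℕ) (v : ℝ) : Continuous (trinomialWeight k v) := by
  unfold trinomialWeight
  fun_prop

lemma integral_trinomialWeight_mul_pow (K m : ℕ) (v : ℝ) :
    ∫ s in (0 : ℝ)..1, trinomialWeight (K + 1) v s * s ^ m =
      ∑ j ∈ range (K + 2), v ^ j * ((K + 1) / 2 ^ K * ((-1) ^ j * ∑ n ∈ range (K + 1),
        (-1) ^ n * K.choose n * (2 * n).choose j * (2 * (K - n)).choose (K + 1 - j) /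
          ((m : ℝ) + 1 + (2 * n - j : ℕ)))) := by
  have hexpand (s : ℝ) : trinomialWeight (K + 1) v s * s ^ m =
      ∑ j ∈ range (K + 2), ∑ n ∈ range (K + 1), (v ^ j * ((K + 1) / 2 ^ K * ((-1) ^ j *
        ((-1) ^ n * K.choose n * (2 * n).choose j * (2 * (K - n)).choose (K + 1 - j))))) *
          s ^ (m + (2 * n - j)) := by
    rw [trinomialWeight, trinomial_sum_eq_coeff, coeff_sq_sub_sq_pow, mul_sum, sum_mul]
    refine sum_congr rfl fun j _ => ?_
    rw [mul_sum, mul_sum, sum_mul]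
    refine sum_congr rfl fun n _ => ?_
    rw [pow_add]
    ring
  simp_rw [hexpand]
  rw [intervalIntegral.integral_finsetSum
      fun _ _ => Continuous.intervalIntegrable (by fun_prop) _ _]
  refine sum_congr rfl fun j _ => ?_
  rw [intervalIntegral.integral_finsetSum
      fun _ _ => Continuous.intervalIntegrable (by fun_prop) _ _,
    mul_sum, mul_sum, mul_sum]
  refine sum_congr rfl fun n _ => ?_
  rw [intervalIntegral.integral_const_mul, integral_pow, one_pow, zero_pow (Nat.succ_ne_zero _)]
  push_cast
  ring

lemma sum_choose_mul_ascPochhammer_div (K m : ℕ) (v : ℝ) :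
    ∑ j ∈ range (K + 2), ((K + 1).choose j : ℝ) * 2 ^ K *
        (ascPochhammer ℝ K).eval (((m : ℝ) - j + 2) / 2) /
        (ascPochhammer ℝ K).eval ((m : ℝ) + 1) * v ^ j =
      (1 + v) ^ (K + 1) + ∫ s in (0 : ℝ)..1, trinomialWeight (K + 1) v s * s ^ m := by
  rw [integral_trinomialWeight_mul_pow, add_comm 1 v, add_pow, ← sum_add_distrib]
  refine sum_congr rfl fun j hj => ?_
  have h := choose_mul_eval_nodal_div_eval_nodal K (Nat.lt_succ_iff.mp (mem_range.mp hj))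
    (x := (m : ℝ) + 1) (by positivity)
  rw [one_pow, mul_one, ← mul_add, ← h, mul_assoc ((K + 1).choose j : ℝ) (2 ^ K),
    two_pow_mul_ascPochhammer_eval_half, ascPochhammer_eval_eq_prod_add, Lagrange.eval_nodal,
    Lagrange.eval_nodal]
  simp_rw [sub_neg_eq_add]
  rw [prod_congr rfl fun (i : ℕ) _ => show (m : ℝ) - j + 2 + 2 * i =
    m + 1 - (j - 1 - 2 * i) by ring]
  ring

end

lemma hasSum_integral_mul_pow_mul_exp {f : ℝ → ℝ} (hf : Continuous f) (ξ : ℝ) :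
    HasSum (fun m : ℕ => (∫ s in (0 : ℝ)..1, f s * s ^ m) * (ξ ^ m / m.factorial))
      (∫ s in (0 : ℝ)..1, f s * Real.exp (s * ξ)) := by
  have hexp (y : ℝ) : HasSum (fun m : ℕ => y ^ m / m.factorial) (Real.exp y) := by
    rw [Real.exp_eq_exp_ℝ]
    exact NormedSpace.expSeries_div_hasSum_exp y
  simp_rw [← intervalIntegral.integral_mul_const]
  refine intervalIntegral.hasSum_integral_of_dominated_convergence
    (fun m s => |f s| * (|ξ| ^ m / m.factorial)) (fun m => ?_) (fun m => ?_) ?_ ?_ ?_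
  · exact Continuous.aestronglyMeasurable (by fun_prop)
  · refine .of_forall fun s hs => ?_
    rw [Set.uIoc_of_le zero_le_one] at hs
    rw [Real.norm_eq_abs, abs_mul, abs_mul, abs_div, abs_pow, abs_pow, Nat.abs_cast]
    gcongr
    rw [abs_of_pos hs.1]
    exact mul_le_of_le_one_right (abs_nonneg _) (pow_le_one₀ hs.1.le hs.2)
  · exact .of_forall fun s _ => (hexp |ξ|).summable.mul_left _
  · simp_rw [tsum_mul_left]
    exact Continuous.intervalIntegrable (by fun_prop) _ _
  · refine .of_forall fun s _ => ?_
    have h := (hexp (s * ξ)).mul_left (f s)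
    simp_rw [mul_pow, mul_div_assoc, ← mul_assoc] at h ⊢
    exact h

theorem bmvA_zero_integral_repr (k : ℕ) (hk : 1 ≤ k) (v ξ : ℝ) :
    bmvA k 0 v ξ =
      (1 + v) ^ k * Real.exp ξ +
        ∫ s in (0:ℝ)..1,
          (∑ ℓ ∈ (Finset.range k).filter (fun ℓ => 2 * ℓ + 2 ≤ k),
            (Nat.factorial k : ℝ) /
                ((Nat.factorial ℓ : ℝ) * (Nat.factorial (ℓ + 1) : ℝ) *
                  (Nat.factorial (k - 2 * ℓ - 2) : ℝ)) *
              (1 + s * v) ^ (k - 2 * ℓ - 2) * ((1 - v ^ 2) / 2) ^ (ℓ + 1) *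
              ((1 - s ^ 2) / 2) ^ ℓ) *
            Real.exp (s * ξ) := by
  obtain ⟨K, rfl⟩ : ∃ K, k = K + 1 := ⟨k - 1, by lia⟩
  have hexp : HasSum (fun m : ℕ => ξ ^ m / m.factorial) (Real.exp ξ) := by
    rw [Real.exp_eq_exp_ℝ]
    exact NormedSpace.expSeries_div_hasSum_exp ξ
  have h := (hexp.mul_left ((1 + v) ^ (K + 1))).add
    (hasSum_integral_mul_pow_mul_exp (continuous_trinomialWeight (K + 1) v) ξ)
  simp_rw [← add_mul, ← sum_choose_mul_ascPochhammer_div, sum_mul, ← mul_div_assoc] at h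
  exact h.tsum_eq
end
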